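/- arXiv:1411.5464 — 2 statements merged into one kernel-verified Lean document; each statement's English description precedes it below -/
import Mathlib

section
/- For all columns a, b, c over A: (a ∨ b) ∧ ((a ∧ b) ∨ c) = (a ∧ (b ∨ c)) ∨ (b ∧ c). -/
/-- One step of Schensted's column matching: try to match the letter `x`
to the smallest still-unmatched letter `y` of the state with `x ≤ y`.
The state is `(remaining unmatched letters of b, matched letters of b)`. -/
def matchStep {n : ℕ} (x : Fin n) (st : Finset (Fin n) × Finset (Fin n)) :
    Finset (Fin n) × Finset (Fin n) :=
  let cand := st.1.filter (fun y => x ≤ y)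
  if h : cand.Nonempty then (st.1.erase (cand.min' h), insert (cand.min' h) st.2)
  else st

/-- `colMatch a b` is the set `b_a` of connected (matched) letters of the column `b`,
obtained by scanning the letters of the column `a` in increasing order and matching
each letter `x` of `a` to the smallest not-yet-matched letter `y` of `b` with `y ≥ x`. -/
def colMatch {n : ℕ} (a b : Finset (Fin n)) : Finset (Fin n) :=
  ((a.sort (· ≤ ·)).foldl (fun st x => matchStep x st) (b, (∅ : Finset (Fin n)))).2

/-- The column `a ∨ b`, with letter set `{a} ∪ b^a`. -/
def vee {n : ℕ} (a b : Finset (Fin n)) : Finset (Fin n) := a ∪ (b \ colMatch a b)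

/-- The column `a ∧ b`, with letter set `b_a`. -/
def wedge {n : ℕ} (a b : Finset (Fin n)) : Finset (Fin n) := colMatch a b

open Classical in
/-- Number of letters of `a` below `k` still waiting for a partner in `b` below `k`. -/
noncomputable def pend (A B : ℕ → Prop) : ℕ → ℕ
  | 0 => 0
  | k + 1 => if B k then pend A B k + (if A k then 1 else 0) - 1
      else pend A B k + (if A k then 1 else 0)

/-- Membership of a natural number in a column. -/
def cmem {n : ℕ} (a : Finset (Fin n)) (k : ℕ) : Prop := ∃ h : k < n, (⟨k, h⟩ : Fin n) ∈ a

theorem cmem_val {n : ℕ} (a : Finset (Fin n)) (i : Fin n) : cmem a i.val ↔ i ∈ a := by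
  simp [cmem]

/-- The final state of the matching. -/
def colState {n : ℕ} (a b : Finset (Fin n)) : Finset (Fin n) × Finset (Fin n) :=
  (a.sort (· ≤ ·)).foldl (fun st x => matchStep x st) (b, (∅ : Finset (Fin n)))

theorem sort_insert_max {n : ℕ} (a : Finset (Fin n)) (x : Fin n) (hx : ∀ y ∈ a, y < x) :
    (insert x a).sort (· ≤ ·) = a.sort (· ≤ ·) ++ [x] := by
  have hxa : x ∉ a := fun h => lt_irrefl _ (hx x h)
  apply List.Perm.eq_of_pairwise (le := (· ≤ ·))
  · intro u v _ _ h1 h2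
    exact le_antisymm h1 h2
  · exact Finset.pairwise_sort _ _
  · rw [List.pairwise_append]
    refine ⟨Finset.pairwise_sort _ _, by simp, ?_⟩
    intro u hu v hv
    simp at hu hv
    subst hv
    exact (hx u hu).le
  · rw [List.perm_ext_iff_of_nodup (Finset.sort_nodup _ _)]
    · intro u
      simp [or_comm]
    · rw [List.nodup_append]
      refine ⟨Finset.sort_nodup _ _, by simp, ?_⟩
      intro u hu v hv
      simp at hu hv
      subst hv
      exact (hx u hu).ne

theorem colState_insert {n : ℕ} (a b : Finset (Fin n)) (x : Fin n) (hx : ∀ y ∈ a, y < x) :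
    colState (insert x a) b = matchStep x (colState a b) := by
  simp [colState, sort_insert_max a x hx]

theorem pend_insert {n : ℕ} (a b : Finset (Fin n)) (x : Fin n) (hx : ∀ y ∈ a, y < x)
    (R : Finset (Fin n))
    (hR : ∀ i : Fin n, i ∈ R ↔ i ∈ b ∧ pend (cmem a) (cmem b) i = 0 ∧ i ∉ a) (k : ℕ)
    (hk : k ≤ n) :
    ((x.val < k ∧ ∀ z ∈ R, x ≤ z → k ≤ z.val) →
      pend (cmem (insert x a)) (cmem b) k = pend (cmem a) (cmem b) k + 1) ∧
    (¬ (x.val < k ∧ ∀ z ∈ R, x ≤ z → k ≤ z.val) →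
      pend (cmem (insert x a)) (cmem b) k = pend (cmem a) (cmem b) k) := by
  induction k with
  | zero => simp [pend]
  | succ k ih =>
    have ih := ih (by omega)
    obtain ⟨i, rfl⟩ : ∃ i : Fin n, i.val = k := ⟨⟨k, by omega⟩, rfl⟩
    simp only [pend, cmem_val, Finset.mem_insert]
    have hRi := hR i
    have hxi : i ∈ a → i < x := hx i
    have hxa : x ∉ a := fun h => lt_irrefl _ (hx x h)
    have key : (x.val < i.val + 1 ∧ ∀ z ∈ R, x ≤ z → i.val + 1 ≤ z.val) ↔
        ((x.val < i.val ∧ ∀ z ∈ R, x ≤ z → i.val ≤ z.val) ∧ i ∉ R) ∨ (i = x ∧ i ∉ R) := by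
      constructor
      · rintro ⟨h1, h2⟩
        have hi : i ∉ R := by
          intro h
          have := h2 i h (by rw [Fin.le_def]; omega)
          omega
        by_cases h : i = x
        · exact Or.inr ⟨h, hi⟩
        · left
          refine ⟨⟨?_, fun z hz hxz => ?_⟩, hi⟩
          · have : i.val ≠ x.val := fun h' => h (Fin.ext h')
            omega
          · have := h2 z hz hxz
            omega
      · rintro (⟨⟨h1, h2⟩, hi⟩ | ⟨rfl, hi⟩)
        · refine ⟨by omega, fun z hz hxz => ?_⟩
          have := h2 z hz hxz
          have : z.val ≠ i.val := fun h' => hi (Fin.ext h' ▸ hz)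
          omega
        · refine ⟨by omega, fun z hz hxz => ?_⟩
          have : z.val ≠ i.val := fun h' => hi (Fin.ext h' ▸ hz)
          rw [Fin.le_def] at hxz
          omega
    rw [key]
    have hlt : i = x → ¬ (x.val < i.val ∧ ∀ z ∈ R, x ≤ z → i.val ≤ z.val) := by
      rintro rfl ⟨h, _⟩
      omega
    have hgt : (x.val < i.val ∧ ∀ z ∈ R, x ≤ z → i.val ≤ z.val) → i ∉ a := by
      rintro ⟨h, _⟩ hi
      have := hx i hi
      rw [Fin.lt_def] at this
      omega
    have hia : i = x → i ∉ a := by rintro rfl; exact hxa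
    generalize (x.val < i.val ∧ ∀ z ∈ R, x ≤ z → i.val ≤ z.val) = C at *
    clear key hxi hR hx
    by_cases hC : C <;> by_cases hix : i = x <;> by_cases hia' : i ∈ a <;>
      by_cases hib : i ∈ b <;> by_cases hiR : i ∈ R <;> simp_all <;> omega

theorem mem_colState {n : ℕ} (a b : Finset (Fin n)) : ∀ i : Fin n,
    (i ∈ (colState a b).2 ↔ i ∈ b ∧ ¬ (pend (cmem a) (cmem b) i = 0 ∧ i ∉ a)) ∧
    (i ∈ (colState a b).1 ↔ i ∈ b ∧ pend (cmem a) (cmem b) i = 0 ∧ i ∉ a) := by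
  induction a using Finset.induction_on_max with
  | empty =>
    have h : ∀ k, pend (cmem (∅ : Finset (Fin n))) (cmem b) k = 0 := by
      intro k
      induction k with
      | zero => rfl
      | succ k ih => simp [pend, ih, cmem]
    intro i
    simp [colState, h]
  | insert x a hx ih =>
    intro i
    rw [colState_insert a b x hx]
    have hp := pend_insert a b x hx (colState a b).1 (fun i => (ih i).2) i i.isLt.le
    have ihi := ih i
    have hxa : x ∉ a := fun h => lt_irrefl _ (hx x h)
    have hxi : x.val < i.val → i ∉ a := by
      intro h hi
      have := hx i hi
      rw [Fin.lt_def] at this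
      omega
    unfold matchStep
    simp only
    split_ifs with hne
    · set y := (Finset.filter (fun y => x ≤ y) (colState a b).1).min' hne with hy
      have hym := Finset.min'_mem _ hne
      rw [← hy, Finset.mem_filter] at hym
      have hmin : ∀ z ∈ (colState a b).1, x ≤ z → y ≤ z := fun z hz hxz =>
        Finset.min'_le _ _ (Finset.mem_filter.2 ⟨hz, hxz⟩)
      have hC : (x.val < i.val ∧ ∀ z ∈ (colState a b).1, x ≤ z → i.val ≤ z.val) ↔
          (x < i ∧ i ≤ y) := by
        constructor
        · rintro ⟨h1, h2⟩
          exact ⟨h1, h2 y hym.1 hym.2⟩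
        · rintro ⟨h1, h2⟩
          exact ⟨h1, fun z hz hxz => le_trans h2 (hmin z hz hxz)⟩
      rw [hC] at hp
      have hmi := hmin i
      have hxi' : x < i → i ∉ a := hxi
      simp only [Finset.mem_insert, Finset.mem_erase]
      clear_value y
      have hyi := ih y
      clear ih hC hmin hxi hy hx
      by_cases hiy : i = y
      · subst hiy
        by_cases hix : i = x
        · subst hix
          simp_all
        · have : x < i := lt_of_le_of_ne hym.2 (Ne.symm hix)
          simp_all
      · by_cases hix : i = x
        · subst hix
          have : i ∉ (colState a b).1 := by
            intro h
            exact hiy (le_antisymm (by exact hym.2) (hmi h le_rfl)) 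
          simp_all
        · by_cases hC : x < i ∧ i ≤ y
          · have : i ∉ (colState a b).1 := by
              intro h
              exact hiy (le_antisymm hC.2 (hmi h hC.1.le))
            have := hp.1 hC
            simp_all
          · have := hp.2 hC
            simp_all
    · have hno : ∀ z ∈ (colState a b).1, ¬ x ≤ z := fun z hz hxz =>
        hne ⟨z, Finset.mem_filter.2 ⟨hz, hxz⟩⟩
      have hC : (x.val < i.val ∧ ∀ z ∈ (colState a b).1, x ≤ z → i.val ≤ z.val) ↔ x < i := by
        constructor
        · rintro ⟨h1, h2⟩
          exact h1
        · intro h1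
          exact ⟨h1, fun z hz hxz => absurd hxz (hno z hz)⟩
      rw [hC] at hp
      have hni := hno i
      clear ih hC hno hne hx
      have hxi' : x < i → i ∉ a := hxi
      clear hxi
      simp only [Finset.mem_insert]
      by_cases hix : i = x
      · subst hix
        simp_all
      · by_cases hlt : x < i
        · have := hp.1 hlt
          have : i ∉ (colState a b).1 := fun h => hni h hlt.le
          simp_all
        · have := hp.2 hlt
          simp_all

theorem mem_wedge {n : ℕ} (a b : Finset (Fin n)) (i : Fin n) :
    i ∈ wedge a b ↔ i ∈ b ∧ ¬ (pend (cmem a) (cmem b) i = 0 ∧ i ∉ a) :=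
  (mem_colState a b i).1

theorem mem_vee {n : ℕ} (a b : Finset (Fin n)) (i : Fin n) :
    i ∈ vee a b ↔ i ∈ a ∨ (i ∈ b ∧ pend (cmem a) (cmem b) i = 0) := by
  have h := mem_wedge a b i
  unfold wedge at h
  simp only [vee, Finset.mem_union, Finset.mem_sdiff, h]
  tauto

theorem pend_invariant {n : ℕ} (a b c : Finset (Fin n)) (k : ℕ) (hk : k ≤ n) :
    pend (cmem (wedge a b)) (cmem c) k =
      min (pend (cmem b) (cmem c) k) (pend (cmem (wedge a (vee b c))) (cmem (wedge b c)) k) ∧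
    pend (cmem a) (cmem b) k = pend (cmem a) (cmem (vee b c)) k +
      (pend (cmem (wedge a (vee b c))) (cmem (wedge b c)) k - pend (cmem b) (cmem c) k) ∧
    pend (cmem (vee a b)) (cmem (vee (wedge a b) c)) k = pend (cmem a) (cmem (vee b c)) k +
      (pend (cmem b) (cmem c) k - pend (cmem (wedge a (vee b c))) (cmem (wedge b c)) k) := by
  induction k with
  | zero => simp [pend]
  | succ k ih =>
    have ih := ih (by omega)
    obtain ⟨i, rfl⟩ : ∃ i : Fin n, i.val = k := ⟨⟨k, by omega⟩, rfl⟩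
    simp only [pend, cmem_val, mem_wedge, mem_vee]
    obtain ⟨h1, h2, h3⟩ := ih
    rw [h1, h2, h3]
    generalize pend (cmem b) (cmem c) i.val = q1
    generalize pend (cmem a) (cmem (vee b c)) i.val = q2
    generalize pend (cmem (wedge a (vee b c))) (cmem (wedge b c)) i.val = q3
    by_cases ha : i ∈ a <;> by_cases hb : i ∈ b <;> by_cases hc : i ∈ c <;>
      simp only [ha, hb, hc, not_true_eq_false, not_false_eq_true, and_true, and_false,
        true_and, false_and, or_true, true_or, or_false, false_or, if_true, if_false] <;>
      refine ⟨?_, ?_, ?_⟩ <;> (repeat' split) <;> omega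

/-- For all columns `a, b, c` over `A`:
`(a ∨ b) ∧ ((a ∧ b) ∨ c) = (a ∧ (b ∨ c)) ∨ (b ∧ c)`. -/
theorem middle_braid (n : ℕ) (hn : 1 ≤ n) (a b c : Finset (Fin n)) :
    wedge (vee a b) (vee (wedge a b) c) = vee (wedge a (vee b c)) (wedge b c) := by
  ext i
  obtain ⟨h1, h2, h3⟩ := pend_invariant a b c i.val i.isLt.le
  simp only [mem_wedge, mem_vee]
  rw [h1, h2, h3]
  generalize pend (cmem b) (cmem c) i.val = q1
  generalize pend (cmem a) (cmem (vee b c)) i.val = q2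
  generalize pend (cmem (wedge a (vee b c))) (cmem (wedge b c)) i.val = q3
  by_cases ha : i ∈ a <;> by_cases hb : i ∈ b <;> by_cases hc : i ∈ c <;>
    simp only [ha, hb, hc, not_true_eq_false, not_false_eq_true, and_true, and_false,
      true_and, false_and, or_true, true_or, or_false, false_or] <;> omega
end

section
/- Every element of the plactic monoid Pl(A) is represented by exactly one word that is a concatenation a_1 a_2 ⋯ a_m of nonempty columns satisfying a_t ∧ a_{t+1} = a_{t+1} for all 1 ≤ t < m (with m = 0 giving the identity element). That is, such words form a complete set of unique normal forms for Pl(A), so the rewriting rules a·b → (a ∨ b)·(a ∧ b) (applied whenever a ∧ b ≠ b) constitute a Gröbner–Shirshov basis of the plactic monoid in the column generators. -/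
/-- The elementary Knuth relations (with contexts): `x z y ≡ z x y` for `x ≤ y < z`
and `y z x ≡ y x z` for `x < y ≤ z`. -/
inductive KnuthRel (n : ℕ) : List (Fin n) → List (Fin n) → Prop
  | knuth1 (u v : List (Fin n)) (x y z : Fin n) (hxy : x ≤ y) (hyz : y < z) :
      KnuthRel n (u ++ x :: z :: y :: v) (u ++ z :: x :: y :: v)
  | knuth2 (u v : List (Fin n)) (x y z : Fin n) (hxy : x < y) (hyz : y ≤ z) :
      KnuthRel n (u ++ y :: z :: x :: v) (u ++ y :: x :: z :: v)

/-- Two words over `A` represent the same element of the plactic monoid `Pl(A)`. -/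
def PlacticEquiv (n : ℕ) : List (Fin n) → List (Fin n) → Prop :=
  Relation.EqvGen (KnuthRel n)

/-- The strictly decreasing word whose letter set is the column `a`. -/
def colWord {n : ℕ} (a : Finset (Fin n)) : List (Fin n) := (a.sort (· ≤ ·)).reverse

namespace Plac

variable {n : ℕ}

/-- Column insertion of one letter, with the list of bumped letters. -/
def ins (x : Fin n) (c : Finset (Fin n)) : Finset (Fin n) × List (Fin n) :=
  if h : (c.filter (fun y => x ≤ y)).Nonempty then
    (insert x (c.erase ((c.filter (fun y => x ≤ y)).min' h)), [(c.filter (fun y => x ≤ y)).min' h])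
  else (insert x c, [])

/-- Feed a word (right to left) into a column. -/
def feed : List (Fin n) → Finset (Fin n) → Finset (Fin n) × List (Fin n)
  | [], c => (c, [])
  | x :: w, c => ((ins x (feed w c).1).1, (ins x (feed w c).1).2 ++ (feed w c).2)

/-- `y` is the least element of `c` that is at least `x`. -/
def Nxt (c : Finset (Fin n)) (x y : Fin n) : Prop := y ∈ c ∧ x ≤ y ∧ ∀ z ∈ c, x ≤ z → y ≤ z

theorem min_eq {c : Finset (Fin n)} {x y : Fin n} (h : Nxt c x y)
    (h' : (c.filter (fun y => x ≤ y)).Nonempty) : (c.filter (fun y => x ≤ y)).min' h' = y := by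
  obtain ⟨h1, h2, h3⟩ := h
  apply le_antisymm
  · apply Finset.min'_le; simp [h1, h2]
  · apply Finset.le_min'
    intro z hz
    simp at hz
    exact h3 z hz.1 hz.2

theorem Nxt.ne {c : Finset (Fin n)} {x y : Fin n} (h : Nxt c x y) :
    (c.filter (fun y => x ≤ y)).Nonempty := ⟨y, by simp [h.1, h.2.1]⟩

theorem ins_bump {c : Finset (Fin n)} {x y : Fin n} (h : Nxt c x y) :
    ins x c = (insert x (c.erase y), [y]) := by
  unfold ins
  rw [dif_pos h.ne, min_eq h]

theorem ins_app {c : Finset (Fin n)} {x : Fin n} (h : ∀ z ∈ c, z < x) :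
    ins x c = (insert x c, []) := by
  unfold ins
  rw [dif_neg]
  rintro ⟨z, hz⟩
  simp at hz
  exact absurd (h z hz.1) (not_lt.2 hz.2)

theorem nxt_or (c : Finset (Fin n)) (x : Fin n) : (∃ y, Nxt c x y) ∨ ∀ z ∈ c, z < x := by
  by_cases h : (c.filter (fun y => x ≤ y)).Nonempty
  · left
    refine ⟨(c.filter (fun y => x ≤ y)).min' h, ?_⟩
    have := Finset.min'_mem _ h
    simp only [Finset.mem_filter] at this
    refine ⟨this.1, this.2, fun z hz hxz => Finset.min'_le _ _ (by simp [hz, hxz])⟩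
  · right
    intro z hz
    by_contra hc
    exact h ⟨z, by simp [hz, not_lt.1 hc]⟩

theorem feed_append (u v : List (Fin n)) (c : Finset (Fin n)) :
    feed (u ++ v) c = ((feed u (feed v c).1).1, (feed u (feed v c).1).2 ++ (feed v c).2) := by
  induction u with
  | nil => simp [feed]
  | cons x u ih => simp [feed, ih]

theorem pe_symm {u v : List (Fin n)} (h : PlacticEquiv n u v) : PlacticEquiv n v u :=
  Relation.EqvGen.symm _ _ h

theorem pe_trans {u v w : List (Fin n)} (h : PlacticEquiv n u v) (h' : PlacticEquiv n v w) :
    PlacticEquiv n u w := Relation.EqvGen.trans _ _ _ h h'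

theorem pe_refl (u : List (Fin n)) : PlacticEquiv n u u := Relation.EqvGen.refl _

theorem pe_app {u v : List (Fin n)} (p q : List (Fin n)) (h : PlacticEquiv n u v) :
    PlacticEquiv n (p ++ u ++ q) (p ++ v ++ q) := by
  induction h with
  | rel a b h =>
    apply Relation.EqvGen.rel
    cases h with
    | knuth1 u v x y z h1 h2 => simpa using KnuthRel.knuth1 (p ++ u) (v ++ q) x y z h1 h2
    | knuth2 u v x y z h1 h2 => simpa using KnuthRel.knuth2 (p ++ u) (v ++ q) x y z h1 h2
  | refl a => exact pe_refl _
  | symm a b _ ih => exact pe_symm ih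
  | trans a b c _ _ ih1 ih2 => exact pe_trans ih1 ih2

theorem pe_left {u v : List (Fin n)} (p : List (Fin n)) (h : PlacticEquiv n u v) :
    PlacticEquiv n (p ++ u) (p ++ v) := by simpa using pe_app p [] h

theorem pe_right {u v : List (Fin n)} (q : List (Fin n)) (h : PlacticEquiv n u v) :
    PlacticEquiv n (u ++ q) (v ++ q) := by simpa using pe_app [] q h

theorem pe_length {u v : List (Fin n)} (h : PlacticEquiv n u v) : u.length = v.length := by
  induction h with
  | rel a b h => cases h <;> simp
  | refl a => rfl
  | symm a b _ ih => exact ih.symm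
  | trans a b c _ _ ih1 ih2 => exact ih1.trans ih2

theorem k1 {x y z : Fin n} (h1 : x ≤ y) (h2 : y < z) (v : List (Fin n)) :
    PlacticEquiv n (x :: z :: y :: v) (z :: x :: y :: v) :=
  Relation.EqvGen.rel _ _ (by simpa using KnuthRel.knuth1 [] v x y z h1 h2)

theorem k2 {x y z : Fin n} (h1 : x < y) (h2 : y ≤ z) (v : List (Fin n)) :
    PlacticEquiv n (y :: z :: x :: v) (y :: x :: z :: v) :=
  Relation.EqvGen.rel _ _ (by simpa using KnuthRel.knuth2 [] v x y z h1 h2)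

/-! Invariance of feeding. -/

/-- Same column, equivalent outputs. -/
def Sim (r s : Finset (Fin n) × List (Fin n)) : Prop := r.1 = s.1 ∧ PlacticEquiv n r.2 s.2

theorem feed3 {c c1 c2 c3 : Finset (Fin n)} {x y z : Fin n} {o1 o2 o3 : List (Fin n)}
    (h1 : ins z c = (c1, o1)) (h2 : ins y c1 = (c2, o2)) (h3 : ins x c2 = (c3, o3)) :
    feed [x, y, z] c = (c3, o3 ++ o2 ++ o1) := by
  simp [feed, h1, h2, h3]

theorem ins_mem (x : Fin n) (c : Finset (Fin n)) : x ∈ (ins x c).1 := by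
  unfold ins; split_ifs <;> simp

/-- Commutation of two separated insertions. -/
theorem ins_comm_bb {c : Finset (Fin n)} {x z x' z' : Fin n} (hx : Nxt c x x') (hz : Nxt c z z')
    (h : x' < z) :
    Nxt (insert z (c.erase z')) x x' ∧ Nxt (insert x (c.erase x')) z z' ∧
    insert x ((insert z (c.erase z')).erase x') = insert z ((insert x (c.erase x')).erase z') := by
  obtain ⟨a1, a2, a3⟩ := hx
  obtain ⟨b1, b2, b3⟩ := hz
  refine ⟨⟨?_, ?_, ?_⟩, ⟨?_, ?_, ?_⟩, ?_⟩
  · grind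
  · grind
  · grind
  · grind
  · grind
  · grind
  · ext t; grind

theorem ins_comm_ba {c : Finset (Fin n)} {x z x' : Fin n} (hx : Nxt c x x') (hz : ∀ t ∈ c, t < z) :
    Nxt (insert z c) x x' ∧ (∀ t ∈ insert x (c.erase x'), t < z) ∧
    insert x ((insert z c).erase x') = insert z (insert x (c.erase x')) := by
  obtain ⟨a1, a2, a3⟩ := hx
  have := hz x' a1
  refine ⟨⟨?_, ?_, ?_⟩, ?_, ?_⟩
  · grind
  · grind
  · grind
  · grind
  · ext t; grind

theorem sim1 {x y z : Fin n} (hxy : x ≤ y) (hyz : y < z) (c : Finset (Fin n)) :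
    Sim (feed [x, z, y] c) (feed [z, x, y] c) := by
  rcases nxt_or c y with ⟨y', hy⟩ | hy
  · have e1 := ins_bump hy
    set c1 := insert y (c.erase y') with hc1
    have hx : ∃ x', Nxt c1 x x' ∧ x' ≤ y := by
      rcases nxt_or c1 x with ⟨x', h⟩ | h
      · exact ⟨x', h, h.2.2 y (by simp [hc1]) hxy⟩
      · exact absurd (h y (by simp [hc1])) (not_lt.2 hxy)
    obtain ⟨x', hx, hx'⟩ := hx
    rcases nxt_or c1 z with ⟨z', hz⟩ | hz
    · obtain ⟨p1, p2, p3⟩ := ins_comm_bb hx hz (lt_of_le_of_lt hx' hyz)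
      rw [feed3 e1 (ins_bump hz) (ins_bump p1), feed3 e1 (ins_bump hx) (ins_bump p2)]
      refine ⟨p3, ?_⟩
      have hlt : y' < z' := by
        obtain ⟨a1, a2, a3⟩ := hy
        obtain ⟨b1, b2, b3⟩ := hz
        grind
      exact k1 (hx'.trans hy.2.1) hlt []
    · obtain ⟨p1, p2, p3⟩ := ins_comm_ba hx hz
      rw [feed3 e1 (ins_app hz) (ins_bump p1), feed3 e1 (ins_bump hx) (ins_app p2)]
      exact ⟨p3, pe_refl _⟩
  · have e1 := ins_app hy
    set c1 := insert y c with hc1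
    have hx : ∃ x', Nxt c1 x x' ∧ x' ≤ y := by
      rcases nxt_or c1 x with ⟨x', h⟩ | h
      · exact ⟨x', h, h.2.2 y (by simp [hc1]) hxy⟩
      · exact absurd (h y (by simp [hc1])) (not_lt.2 hxy)
    obtain ⟨x', hx, hx'⟩ := hx
    have hz : ∀ t ∈ c1, t < z := by
      intro t ht
      rcases Finset.mem_insert.1 ht with rfl | ht
      · exact hyz
      · exact (hy t ht).trans hyz
    obtain ⟨p1, p2, p3⟩ := ins_comm_ba hx hz
    rw [feed3 e1 (ins_app hz) (ins_bump p1), feed3 e1 (ins_bump hx) (ins_app p2)]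
    exact ⟨p3, pe_refl _⟩

theorem sim2 {x y z : Fin n} (hxy : x < y) (hyz : y ≤ z) (c : Finset (Fin n)) :
    Sim (feed [y, z, x] c) (feed [y, x, z] c) := by
  rcases nxt_or c x with ⟨x', hx⟩ | hx
  · by_cases hlt : x' < z
    · rcases nxt_or c z with ⟨z', hz⟩ | hz
      · obtain ⟨p1, p2, p3⟩ := ins_comm_bb hx hz hlt
        have hy : ∃ y', Nxt (insert z ((insert x (c.erase x')).erase z')) y y' ∧ y' ≤ z := by
          rcases nxt_or (insert z ((insert x (c.erase x')).erase z')) y with ⟨y', h⟩ | h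
          · exact ⟨y', h, h.2.2 z (by simp) hyz⟩
          · exact absurd (h z (by simp)) (not_lt.2 hyz)
        obtain ⟨y', hy, hyz'⟩ := hy
        have hy2 := hy
        rw [← p3] at hy2
        rw [feed3 (ins_bump hx) (ins_bump p2) (ins_bump hy),
          feed3 (ins_bump hz) (ins_bump p1) (ins_bump hy2)]
        refine ⟨by simp [p3], ?_⟩
        have h1 : x' < y' := by
          obtain ⟨a1, a2, a3⟩ := hx
          obtain ⟨b1, b2, b3⟩ := hy
          grind
        exact k2 h1 (hyz'.trans hz.2.1) []
      · obtain ⟨p1, p2, p3⟩ := ins_comm_ba hx hz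
        have h : ∀ (c' : Finset (Fin n)), feed [y] c' = (((ins y c').1), (ins y c').2) := by
          intro c'; simp [feed]
        have e1 : feed [z, x] c = (insert z (insert x (c.erase x')), [x']) := by
          simp [feed, ins_bump hx, ins_app p2]
        have e2 : feed [x, z] c = (insert z (insert x (c.erase x')), [x']) := by
          simp [feed, ins_app hz, ins_bump p1, p3]
        rw [show feed [y, z, x] c = feed [y, x, z] c by
          rw [feed, e1, feed, e2]]
        exact ⟨rfl, pe_refl _⟩
    · have hzx := not_lt.1 hlt
      have hz : Nxt c z x' := ⟨hx.1, hzx, fun t ht h => hx.2.2 t ht ((hxy.le.trans hyz).trans h)⟩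
      obtain ⟨a1, a2, a3⟩ := hx
      -- second: x bumps z
      have q1 : Nxt (insert z (c.erase x')) x z := by
        refine ⟨by simp, hxy.le.trans hyz, ?_⟩
        grind
      rcases nxt_or (insert x (c.erase x')) z with ⟨w, hw⟩ | hw
      · obtain ⟨b1, b2, b3⟩ := hw
        have hxw : x' < w := by grind
        have r1 : Nxt (insert z ((insert x (c.erase x')).erase w)) y z := by
          refine ⟨by simp, hyz, ?_⟩
          grind
        have r2 : Nxt (insert x ((insert z (c.erase x')).erase z)) y w := by
          refine ⟨?_, ?_, ?_⟩
          · grind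
          · grind
          · grind
        rw [feed3 (ins_bump ⟨a1, a2, a3⟩) (ins_bump ⟨b1, b2, b3⟩) (ins_bump r1),
          feed3 (ins_bump hz) (ins_bump q1) (ins_bump r2)]
        refine ⟨?_, ?_⟩
        · ext t; grind
        · exact k1 hzx hxw []
      · have r1 : Nxt (insert z (insert x (c.erase x'))) y z := by
          refine ⟨by simp, hyz, ?_⟩
          grind
        have r2 : ∀ t ∈ insert x ((insert z (c.erase x')).erase z), t < y := by
          grind
        rw [feed3 (ins_bump ⟨a1, a2, a3⟩) (ins_app hw) (ins_bump r1),
          feed3 (ins_bump hz) (ins_bump q1) (ins_app r2)]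
        refine ⟨?_, pe_refl _⟩
        ext t; grind
  · have h1 : ∀ t ∈ insert x c, t < z := by grind
    have h2 : Nxt (insert z (insert x c)) y z := by
      refine ⟨by simp, hyz, ?_⟩
      grind
    have h3 : ∀ t ∈ c, t < z := by grind
    have h4 : Nxt (insert z c) x z := by
      refine ⟨by simp, hxy.le.trans hyz, ?_⟩
      grind
    have h5 : ∀ t ∈ insert x ((insert z c).erase z), t < y := by grind
    rw [feed3 (ins_app hx) (ins_app h1) (ins_bump h2),
      feed3 (ins_app h3) (ins_bump h4) (ins_app h5)]
    refine ⟨?_, pe_refl _⟩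
    ext t; grind

theorem sim_ctx {p q : List (Fin n)} (h : ∀ c, Sim (feed p c) (feed q c)) (u v : List (Fin n))
    (c : Finset (Fin n)) : Sim (feed (u ++ (p ++ v)) c) (feed (u ++ (q ++ v)) c) := by
  simp only [feed_append, Sim]
  obtain ⟨h1, h2⟩ := h (feed v c).1
  rw [h1]
  exact ⟨rfl, pe_left _ (pe_right _ h2)⟩

theorem feed_inv {u v : List (Fin n)} (h : PlacticEquiv n u v) (c : Finset (Fin n)) :
    Sim (feed u c) (feed v c) := by
  induction h with
  | rel a b h =>
    cases h with
    | knuth1 u v x y z h1 h2 => exact sim_ctx (sim1 h1 h2) u v c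
    | knuth2 u v x y z h1 h2 => exact sim_ctx (sim2 h1 h2) u v c
  | refl a => exact ⟨rfl, pe_refl _⟩
  | symm a b _ ih => exact ⟨ih.1.symm, pe_symm ih.2⟩
  | trans a b c _ _ ih1 ih2 => exact ⟨ih1.1.trans ih2.1, pe_trans ih1.2 ih2.2⟩

/-! Column words. -/

theorem colWord_pairwise (c : Finset (Fin n)) : (colWord c).Pairwise (· > ·) := by
  unfold colWord
  rw [List.pairwise_reverse]
  exact (Finset.sortedLT_sort c).pairwise

theorem mem_colWord {c : Finset (Fin n)} {x : Fin n} : x ∈ colWord c ↔ x ∈ c := by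
  simp [colWord]

theorem colWord_eq {c : Finset (Fin n)} {l : List (Fin n)} (h : l.Pairwise (· > ·))
    (hm : ∀ x, x ∈ l ↔ x ∈ c) : colWord c = l := by
  refine List.Perm.eq_of_pairwise (le := (· > ·)) ?_ (colWord_pairwise c) h ?_
  · intro a b _ _ h1 h2; exact absurd h1 (lt_asymm h2)
  · rw [List.perm_ext_iff_of_nodup]
    · intro a; rw [mem_colWord, hm]
    · exact (colWord_pairwise c).imp (fun h => ne_of_gt h)
    · exact h.imp (fun h => ne_of_gt h)

theorem move1 {x y : Fin n} (hxy : x ≤ y) (p q : List (Fin n))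
    (hp : (p ++ [y]).Pairwise (· > ·)) :
    PlacticEquiv n (x :: (p ++ y :: q)) (p ++ x :: y :: q) := by
  induction p with
  | nil => exact pe_refl _
  | cons a p ih =>
    simp only [List.cons_append, List.pairwise_cons] at hp
    have ih := pe_left [a] (ih hp.2)
    refine pe_trans ?_ ih
    have hp2 := hp.2
    cases p with
    | nil => exact k1 hxy (hp.1 y (by simp)) q
    | cons b p =>
      simp only [List.cons_append, List.pairwise_cons] at hp2
      exact k1 (hxy.trans (hp2.1 y (by simp)).le) (hp.1 b (by simp)) _

theorem move2 {x y : Fin n} (hxy : x ≤ y) (q : List (Fin n))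
    (hq : (x :: q).Pairwise (· > ·)) :
    PlacticEquiv n (x :: y :: q) (x :: q ++ [y]) := by
  induction q generalizing x with
  | nil => exact pe_refl _
  | cons a q ih =>
    rw [List.pairwise_cons] at hq
    have hax := hq.1 a (by simp)
    refine pe_trans (k2 hax hxy q) ?_
    exact pe_left [x] (ih (hax.le.trans hxy) hq.2)

theorem ins_word (x : Fin n) (c : Finset (Fin n)) :
    PlacticEquiv n (x :: colWord c) (colWord (ins x c).1 ++ (ins x c).2) := by
  rcases nxt_or c x with ⟨y, hy⟩ | hx
  · rw [ins_bump hy]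
    obtain ⟨h1, h2, h3⟩ := hy
    obtain ⟨p, q, hpq⟩ := List.append_of_mem (mem_colWord.2 h1)
    have hs := colWord_pairwise c
    have hm : ∀ t, t ∈ p ++ y :: q ↔ t ∈ c := fun t => by rw [← hpq, mem_colWord]
    rw [hpq] at hs
    have hs' := hs
    rw [List.pairwise_append, List.pairwise_cons] at hs
    obtain ⟨s1, ⟨s2, s3⟩, s4⟩ := hs
    have hqx : ∀ t ∈ q, t < x := by
      intro t ht
      by_contra hc
      exact absurd (h3 t ((hm t).1 (by simp [ht])) (not_lt.1 hc)) (not_le.2 (s2 t ht))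
    have hxq : (x :: q).Pairwise (· > ·) := List.pairwise_cons.2 ⟨hqx, s3⟩
    have hw : colWord (insert x (c.erase y)) = p ++ x :: q := by
      apply colWord_eq
      · rw [List.pairwise_append]
        refine ⟨s1, hxq, ?_⟩
        intro a ha b hb
        have hay := s4 a ha y (by simp)
        rcases List.mem_cons.1 hb with rfl | hb
        · exact lt_of_le_of_lt h2 hay
        · exact s4 a ha b (by simp [hb])
      · intro t
        have := hm t
        have hyp : ∀ a ∈ p, a ≠ y := fun a ha => ne_of_gt (s4 a ha y (by simp))
        have hyq : ∀ a ∈ q, a ≠ y := fun a ha => ne_of_lt (s2 a ha)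
        simp only [List.mem_append, List.mem_cons, Finset.mem_insert, Finset.mem_erase] at this ⊢
        grind
    rw [hw, hpq]
    refine pe_trans (move1 h2 p q ?_) ?_
    · refine hs'.sublist ?_
      simp
    · simpa using pe_left p (move2 h2 q hxq)
  · rw [ins_app hx]
    have : colWord (insert x c) = x :: colWord c := by
      apply colWord_eq
      · rw [List.pairwise_cons]
        exact ⟨fun t ht => hx t (mem_colWord.1 ht), colWord_pairwise c⟩
      · intro t; simp [mem_colWord]
    rw [this]; simpa using pe_refl _

theorem feed_word (w : List (Fin n)) (c : Finset (Fin n)) :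
    PlacticEquiv n (w ++ colWord c) (colWord (feed w c).1 ++ (feed w c).2) := by
  induction w with
  | nil => simpa [feed] using pe_refl _
  | cons x w ih =>
    refine pe_trans (pe_left [x] ih) ?_
    simpa [feed] using pe_right (feed w c).2 (ins_word x (feed w c).1)

/-! Matching. -/

theorem matchStep_bump {x y : Fin n} {R M : Finset (Fin n)} (h : Nxt R x y) :
    matchStep x (R, M) = (R.erase y, insert y M) := by
  unfold matchStep
  simp only
  rw [dif_pos h.ne, min_eq h]

theorem matchStep_none {x : Fin n} {R M : Finset (Fin n)} (h : ∀ z ∈ R, z < x) :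
    matchStep x (R, M) = (R, M) := by
  unfold matchStep
  simp only
  rw [dif_neg]
  rintro ⟨z, hz⟩
  simp at hz
  exact absurd (h z hz.1) (not_lt.2 hz.2)

/-- Fold of the matching. -/
def mf (as : List (Fin n)) (st : Finset (Fin n) × Finset (Fin n)) :=
  as.foldl (fun st x => matchStep x st) st

theorem mf_inv (as : List (Fin n)) (R M : Finset (Fin n)) (h : Disjoint R M) :
    Disjoint (mf as (R, M)).1 (mf as (R, M)).2 ∧
      (mf as (R, M)).1 ∪ (mf as (R, M)).2 = R ∪ M := by
  induction as generalizing R M with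
  | nil => exact ⟨h, rfl⟩
  | cons x as ih =>
    simp only [mf, List.foldl_cons] at ih ⊢
    rcases nxt_or R x with ⟨y, hy⟩ | hx
    · rw [matchStep_bump hy]
      have := ih (R.erase y) (insert y M) (by
        rw [Finset.disjoint_left] at h ⊢
        intro a ha; have := @h a; grind)
      refine ⟨this.1, this.2.trans ?_⟩
      have := hy.1
      ext t; grind
    · rw [matchStep_none hx]; exact ih R M h

theorem wedge_iff (a b : Finset (Fin n)) :
    wedge a b = b ↔ (mf (a.sort (· ≤ ·)) (b, ∅)).1 = ∅ := by
  obtain ⟨h1, h2⟩ := mf_inv (a.sort (· ≤ ·)) b ∅ (by simp)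
  change (mf (a.sort (· ≤ ·)) (b, ∅)).2 = b ↔ _
  set r := mf (a.sort (· ≤ ·)) (b, ∅)
  rw [Finset.union_empty] at h2
  constructor
  · intro h
    rw [h] at h1 h2
    rw [Finset.union_eq_right] at h2
    exact Finset.disjoint_self_iff_empty _ |>.1 (h1.mono_right h2)
  · intro h
    rw [h] at h2
    simpa using h2

theorem mf_low (as : List (Fin n)) (R M : Finset (Fin n)) (r : Fin n) (hr : r ∈ R)
    (h : ∀ a ∈ as, r < a) : r ∈ (mf as (R, M)).1 := by
  induction as generalizing R M with
  | nil => exact hr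
  | cons x as ih =>
    simp only [mf, List.foldl_cons] at ih ⊢
    have hrx := h x (by simp)
    have h' : ∀ a ∈ as, r < a := fun a ha => h a (by simp [ha])
    rcases nxt_or R x with ⟨y, hy⟩ | hx
    · rw [matchStep_bump hy]
      refine ih _ _ ?_ h'
      rw [Finset.mem_erase]
      exact ⟨(lt_of_lt_of_le hrx hy.2.1).ne, hr⟩
    · rw [matchStep_none hx]; exact ih R M hr h'

theorem feed_mf (as : List (Fin n)) (hs : as.Pairwise (· < ·)) (s R M : Finset (Fin n))
    (h : ∀ a ∈ as, ∀ t ∈ s, t < a) (hm : (mf as (R, M)).1 = ∅) :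
    feed as.reverse (s ∪ R) = (s ∪ as.toFinset, colWord R) := by
  induction as generalizing s R M with
  | nil =>
    have : R = ∅ := hm
    subst this
    simp [feed, colWord]
  | cons a as ih =>
    rw [List.pairwise_cons] at hs
    have hR : ∀ r ∈ R, a ≤ r := by
      intro r hr
      by_contra hc
      have := mf_low (a :: as) R M r hr (by
        intro b hb
        rcases List.mem_cons.1 hb with rfl | hb
        · exact not_le.1 hc
        · exact (not_le.1 hc).trans (hs.1 b hb))
      rw [hm] at this
      simp at this
    have hsa := h a (by simp)
    have hn : ∀ b ∈ as, ∀ t ∈ insert a s, t < b := by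
      intro b hb t ht
      rcases Finset.mem_insert.1 ht with rfl | ht
      · exact hs.1 b hb
      · exact h b (by simp [hb]) t ht
    rw [List.reverse_cons, feed_append]
    simp only [mf, List.foldl_cons] at ih hm
    rcases nxt_or R a with ⟨y, hy⟩ | hx
    · rw [matchStep_bump hy] at hm
      have ih := ih hs.2 (insert a s) (R.erase y) _ hn hm
      have hy' : Nxt (s ∪ R) a y := by
        obtain ⟨h1, h2, h3⟩ := hy
        refine ⟨by simp [h1], h2, ?_⟩
        grind
      have e : feed [a] (s ∪ R) = (insert a s ∪ R.erase y, [y]) := by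
        simp only [feed, ins_bump hy', List.append_nil, Prod.mk.injEq, and_true]
        have := fun t ht => (hsa t ht).trans_le hy.2.1
        ext t; grind
      rw [e, ih]
      refine Prod.ext ?_ ?_
      · ext t; simp
      · symm
        apply colWord_eq
        · rw [List.pairwise_append]
          refine ⟨colWord_pairwise _, by simp, ?_⟩
          intro b hb c hc
          rw [mem_colWord, Finset.mem_erase] at hb
          simp only [List.mem_singleton] at hc
          subst hc
          exact lt_of_le_of_ne (hy.2.2 b hb.2 (hR b hb.2)) (Ne.symm hb.1)
        · intro t
          have := hy.1
          simp only [List.mem_append, mem_colWord, Finset.mem_erase, List.mem_singleton]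
          grind
    · rw [matchStep_none hx] at hm
      have ih := ih hs.2 (insert a s) R _ hn hm
      have hR0 : R = ∅ := by
        apply Finset.eq_empty_of_forall_notMem
        intro r hr
        exact absurd (hx r hr) (not_lt.2 (hR r hr))
      subst hR0
      have e : feed [a] (s ∪ ∅) = (insert a s ∪ ∅, []) := by
        rw [feed, feed, ins_app (by simpa using hsa)]
        simp
      rw [e, ih]
      refine Prod.ext ?_ ?_
      · ext t; simp
      · simp

theorem feed_col {a b : Finset (Fin n)} (h : wedge a b = b) :
    feed (colWord a) b = (a, colWord b) := by
  rw [wedge_iff] at h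
  have := feed_mf _ (Finset.sortedLT_sort a).pairwise ∅ b ∅ (by simp) h
  simpa [colWord] using this

theorem wedge_empty (a : Finset (Fin n)) : wedge a ∅ = ∅ := by
  obtain ⟨-, h2⟩ := mf_inv (a.sort (· ≤ ·)) ∅ ∅ (by simp)
  rw [wedge_iff]
  rw [Finset.union_empty, Finset.union_eq_empty] at h2
  exact h2.1

theorem feed_normal (a : Finset (Fin n)) (L : List (Finset (Fin n)))
    (h : List.IsChain (fun a b => wedge a b = b) (a :: L)) :
    feed ((a :: L).map colWord).flatten ∅ = (a, (L.map colWord).flatten) := by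
  induction L generalizing a with
  | nil =>
    simpa [colWord] using feed_col (wedge_empty a)
  | cons b L ih =>
    rw [List.isChain_cons_cons] at h
    have ih := ih b h.2
    rw [List.map_cons, List.flatten_cons, feed_append, ih, feed_col h.1]
    simp

theorem colWord_ne {c : Finset (Fin n)} (h : c.Nonempty) : colWord c ≠ [] := by
  obtain ⟨x, hx⟩ := h
  exact List.ne_nil_of_mem (mem_colWord.2 hx)

theorem unique_nf (L L' : List (Finset (Fin n))) (h1 : ∀ c ∈ L, c.Nonempty)
    (h1' : ∀ c ∈ L', c.Nonempty)
    (h2 : List.IsChain (fun a b => wedge a b = b) L)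
    (h2' : List.IsChain (fun a b => wedge a b = b) L')
    (h : PlacticEquiv n (L.map colWord).flatten (L'.map colWord).flatten) : L = L' := by
  induction L generalizing L' with
  | nil =>
    cases L' with
    | nil => rfl
    | cons b L' =>
      have := pe_length h
      have hb := List.length_pos_iff.2 (colWord_ne (h1' b (by simp)))
      simp at this
      omega
  | cons a L ih =>
    cases L' with
    | nil =>
      have := pe_length h
      have hb := List.length_pos_iff.2 (colWord_ne (h1 a (by simp)))
      simp at this
      simp [this.1] at hb
    | cons b L' =>
      have := feed_inv h ∅
      rw [feed_normal a L h2, feed_normal b L' h2'] at this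
      obtain ⟨e1, e2⟩ := this
      simp only at e1 e2
      rw [e1, ih L' (fun c hc => h1 c (by simp [hc])) (fun c hc => h1' c (by simp [hc]))
        h2.tail h2'.tail e2]

/-! Existence. -/

/-- Domination of columns through counting. -/
def Dom (c d : Finset (Fin n)) : Prop :=
  ∀ t, (d.filter (· ≤ t)).card ≤ (c.filter (· ≤ t)).card

theorem mf_dom (as : List (Fin n)) (hs : as.Pairwise (· < ·)) (R M : Finset (Fin n))
    (h : ∀ t, (R.filter (· ≤ t)).card ≤ (as.toFinset.filter (· ≤ t)).card) :
    (mf as (R, M)).1 = ∅ := by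
  induction as generalizing R M with
  | nil =>
    change R = ∅
    apply Finset.eq_empty_of_forall_notMem
    intro r hr
    have := h r
    simp only [List.toFinset_nil, Finset.filter_empty, Finset.card_empty, Nat.le_zero,
      Finset.card_eq_zero] at this
    have h2 : r ∈ R.filter (· ≤ r) := by simp [hr]
    rw [this] at h2
    simp at h2
  | cons a as ih =>
    rw [List.pairwise_cons] at hs
    simp only [mf, List.foldl_cons] at ih ⊢
    have hR : ∀ r ∈ R, a ≤ r := by
      intro r hr
      by_contra hc
      have h2 : r ∈ R.filter (· ≤ r) := by simp [hr]
      have h3 := (Finset.card_pos.2 ⟨r, h2⟩).trans_le (h r)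
      obtain ⟨b, hb⟩ := Finset.card_pos.1 h3
      simp only [List.toFinset_cons, Finset.mem_filter, Finset.mem_insert, List.mem_toFinset] at hb
      obtain ⟨rfl | hb, hbr⟩ := hb
      · exact hc hbr
      · exact hc ((hs.1 b hb).le.trans hbr)
    rcases nxt_or R a with ⟨y, hy⟩ | hx
    · rw [matchStep_bump hy]
      apply ih hs.2
      intro t
      by_cases hyt : y ≤ t
      · have e1 : (R.filter (· ≤ t)).card = ((R.erase y).filter (· ≤ t)).card + 1 := by
          rw [Finset.filter_erase, Finset.card_erase_add_one]
          simp [hy.1, hyt]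
        have e2 : ((a :: as).toFinset.filter (· ≤ t)).card =
            (as.toFinset.filter (· ≤ t)).card + 1 := by
          rw [List.toFinset_cons, Finset.filter_insert, if_pos (hy.2.1.trans hyt),
            Finset.card_insert_of_notMem]
          simp only [Finset.mem_filter, List.mem_toFinset, not_and]
          intro ha
          exact absurd (hs.1 a ha) (lt_irrefl _)
        have := h t
        omega
      · have : (R.erase y).filter (· ≤ t) = ∅ := by
          apply Finset.eq_empty_of_forall_notMem
          intro r hr
          simp only [Finset.mem_filter, Finset.mem_erase] at hr
          exact hyt ((hy.2.2 r hr.1.2 (hR r hr.1.2)).trans hr.2)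
        simp [this]
    · rw [matchStep_none hx]
      apply ih hs.2
      intro t
      have hR0 : R = ∅ := by
        apply Finset.eq_empty_of_forall_notMem
        intro r hr
        exact absurd (hx r hr) (not_lt.2 (hR r hr))
      simp [hR0]

theorem wedge_of_dom {a b : Finset (Fin n)} (h : Dom a b) : wedge a b = b := by
  rw [wedge_iff]
  apply mf_dom _ (Finset.sortedLT_sort a).pairwise
  simpa [Dom] using h

theorem count_bump {c : Finset (Fin n)} {x y : Fin n} (h : Nxt c x y) (t : Fin n) :
    ((insert x (c.erase y)).filter (· ≤ t)).card =
      (c.filter (· ≤ t)).card + if x ≤ t ∧ t < y then 1 else 0 := by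
  obtain ⟨h1, h2, h3⟩ := h
  by_cases hxy : x = y
  · subst hxy
    rw [Finset.insert_erase h1, if_neg (fun h => absurd h.1 (not_le.2 h.2))]; rfl
  have hxc : x ∉ c := fun hx => hxy (le_antisymm h2 (h3 x hx le_rfl))
  rw [Finset.filter_insert, Finset.filter_erase]
  by_cases hxt : x ≤ t
  · rw [if_pos hxt, Finset.card_insert_of_notMem (by simp [hxc])]
    by_cases hty : t < y
    · rw [if_pos ⟨hxt, hty⟩, Finset.erase_eq_of_notMem]
      simp [hty]
    · rw [if_neg (fun h => hty h.2), Finset.card_erase_add_one]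
      · rfl
      · simp [h1, not_lt.1 hty]
  · rw [if_neg hxt, if_neg (fun h => hxt h.1), Finset.erase_eq_of_notMem]
    · rfl
    · simp only [Finset.mem_filter, not_and]
      intro _ hy; exact hxt (h2.trans hy)

theorem count_app {c : Finset (Fin n)} {x : Fin n} (h : ∀ z ∈ c, z < x) (t : Fin n) :
    ((insert x c).filter (· ≤ t)).card =
      (c.filter (· ≤ t)).card + if x ≤ t then 1 else 0 := by
  have hxc : x ∉ c := fun hx => absurd (h x hx) (lt_irrefl _)
  rw [Finset.filter_insert]
  by_cases hxt : x ≤ t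
  · rw [if_pos hxt, if_pos hxt, Finset.card_insert_of_notMem (by simp [hxc])]
  · rw [if_neg hxt, if_neg hxt]; rfl

theorem dom_step {c d : Finset (Fin n)} {x y : Fin n} (hd : Dom c d) (h : Nxt c x y) :
    Dom (insert x (c.erase y)) (ins y d).1 := by
  intro t
  rw [count_bump h]
  have key : ∀ s, y ≤ s → (∀ z ∈ d, y ≤ z → s < z) →
      (d.filter (· ≤ s)).card + 1 ≤ (c.filter (· ≤ s)).card := by
    intro s hs hz
    have h2 : (c.filter (· < y)).card + 1 ≤ (c.filter (· ≤ s)).card := by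
      rw [← Finset.card_insert_of_notMem (a := y) (by simp)]
      apply Finset.card_le_card
      intro r hr
      have := h.1
      simp only [Finset.mem_insert, Finset.mem_filter] at hr ⊢
      rcases hr with rfl | hr
      · exact ⟨this, hs⟩
      · exact ⟨hr.1, hr.2.le.trans hs⟩
    have h1 : (d.filter (· ≤ s)).card ≤ (c.filter (· < y)).card := by
      rcases Finset.eq_empty_or_nonempty (d.filter (· ≤ s)) with he | hne
      · simp [he]
      · set m := (d.filter (· ≤ s)).max' hne with hm
        have hmm := Finset.max'_mem _ hne
        rw [← hm] at hmm
        simp only [Finset.mem_filter] at hmm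
        have hmy : m < y := by
          by_contra hc
          exact absurd (hz m hmm.1 (not_lt.1 hc)) (not_lt.2 hmm.2)
        have a1 : d.filter (· ≤ s) ⊆ d.filter (· ≤ m) := by
          intro r hr
          have := Finset.le_max' _ r hr
          simp only [Finset.mem_filter] at hr ⊢
          exact ⟨hr.1, this⟩
        have a2 : c.filter (· ≤ m) ⊆ c.filter (· < y) := by
          intro r hr
          simp only [Finset.mem_filter] at hr ⊢
          exact ⟨hr.1, hr.2.trans_lt hmy⟩
        exact ((Finset.card_le_card a1).trans (hd m)).trans (Finset.card_le_card a2)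
    omega
  have hdt := hd t
  rcases nxt_or d y with ⟨z, hz⟩ | hz
  · rw [ins_bump hz, count_bump hz]
    by_cases hc : y ≤ t ∧ t < z
    · have := key t hc.1 (fun w hw hyw => hc.2.trans_le (hz.2.2 w hw hyw))
      rw [if_pos hc]; omega
    · rw [if_neg hc]; omega
  · rw [ins_app hz, count_app hz]
    by_cases hc : y ≤ t
    · have := key t hc (fun w hw hyw => absurd (hz w hw) (not_lt.2 hyw))
      rw [if_pos hc]; omega
    · rw [if_neg hc]; omega

theorem feed_dom (w : List (Fin n)) : Dom (feed w ∅).1 (feed (feed w ∅).2 ∅).1 := by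
  induction w with
  | nil => intro t; simp [feed]
  | cons x w ih =>
    simp only [feed]
    rcases nxt_or (feed w ∅).1 x with ⟨y, hy⟩ | hx
    · rw [ins_bump hy]
      exact dom_step ih hy
    · rw [ins_app hx]
      intro t
      have := ih t
      rw [count_app hx]
      simp only [List.nil_append]
      omega

theorem ins_len (x : Fin n) (c : Finset (Fin n)) : (ins x c).2.length ≤ 1 := by
  unfold ins; split_ifs <;> simp

theorem feed_len (w : List (Fin n)) (hw : w ≠ []) : (feed w ∅).2.length < w.length := by
  induction w with
  | nil => exact absurd rfl hw
  | cons x w ih =>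
    by_cases h : w = []
    · subst h
      rw [feed, feed, ins_app (by simp)]
      simp
    · have := ih h
      have := ins_len x (feed w ∅).1
      simp only [feed, List.length_append, List.length_cons]
      omega

theorem exists_nf (k : ℕ) (w : List (Fin n)) (hk : w.length ≤ k) :
    ∃ L : List (Finset (Fin n)), (∀ c ∈ L, c.Nonempty) ∧
      List.IsChain (fun a b => wedge a b = b) L ∧
      PlacticEquiv n (L.map colWord).flatten w ∧ ∀ d ∈ L.head?, d = (feed w ∅).1 := by
  induction k generalizing w with
  | zero =>
    have : w = [] := List.length_eq_zero_iff.1 (Nat.le_zero.1 hk)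
    subst this
    exact ⟨[], by simp, by simp, pe_refl _, by simp⟩
  | succ k ih =>
    by_cases hw : w = []
    · subst hw
      exact ⟨[], by simp, by simp, pe_refl _, by simp⟩
    · have hl := feed_len w hw
      obtain ⟨L, l1, l2, l3, l4⟩ := ih (feed w ∅).2 (by omega)
      refine ⟨(feed w ∅).1 :: L, ?_, ?_, ?_, ?_⟩
      · intro c hc
        rcases List.mem_cons.1 hc with rfl | hc
        · cases w with
          | nil => exact absurd rfl hw
          | cons x w => exact ⟨x, ins_mem x _⟩
        · exact l1 c hc
      · rw [List.isChain_cons]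
        refine ⟨?_, l2⟩
        intro d hd
        rw [l4 d hd]
        exact wedge_of_dom (feed_dom w)
      · have := feed_word w ∅
        rw [show colWord (∅ : Finset (Fin n)) = [] by simp [colWord], List.append_nil] at this
        refine pe_trans ?_ (pe_symm this)
        simpa using pe_left (colWord (feed w ∅).1) l3
      · simp

end Plac

/-- Every element of the plactic monoid `Pl(A)` is represented by exactly one word
that is a concatenation `a_1 a_2 ⋯ a_m` of nonempty columns satisfying
`a_t ∧ a_{t+1} = a_{t+1}` for all `1 ≤ t < m` (with `m = 0` giving the identity):
such words are a complete set of unique normal forms for `Pl(A)`, so the rewriting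
rules `a·b → (a ∨ b)·(a ∧ b)` (applied whenever `a ∧ b ≠ b`) constitute a
Gröbner–Shirshov basis of the plactic monoid in the column generators. -/
theorem column_normal_form (n : ℕ) (hn : 1 ≤ n) (w : List (Fin n)) :
    ∃! L : List (Finset (Fin n)),
      (∀ c ∈ L, c.Nonempty) ∧
      List.Chain' (fun a b => wedge a b = b) L ∧
      PlacticEquiv n (L.map colWord).flatten w := by
  obtain ⟨L, l1, l2, l3, -⟩ := Plac.exists_nf w.length w le_rfl
  refine ⟨L, ⟨l1, l2, l3⟩, ?_⟩
  rintro L' ⟨h1, h2, h3⟩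
  exact Plac.unique_nf L' L h1 l1 h2 l2 (Plac.pe_trans h3 (Plac.pe_symm l3))
end
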